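/- Let q be a prime with q ≡ 3 (mod 4), let Q be the Paley core of order q, and define: H₄ the 4 × 4 matrix [[1,1,1,−1],[1,1,−1,1],[1,−1,1,1],[−1,1,1,1]]; P = Q ⊗ H₄ − I_q ⊗ J₄ (a 4q × 4q {±1} matrix); R the 3q × 4q matrix j_q ⊗ [[1,−1,1,−1],[1,1,−1,−1],[1,−1,−1,1]], where j_q is the all-ones row vector of length q; and M the (4q+3) × (4q+3) block matrix M = [[P, Rᵀ], [R, J₃]], where J₃ is the 3 × 3 all-ones matrix. Then det(M·Mᵀ) = 16·(4q)^(3q+3)·(4q+16)^(q−1). -/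

import Mathlib

open Matrix Kronecker

/-- Sylvester's determinant identity with a scalar parameter that need not be invertible. -/
lemma Matrix.pow_card_mul_det_smul_one_add_mul_comm {R m n : Type*} [CommRing R]
    [Fintype m] [DecidableEq m] [Fintype n] [DecidableEq n]
    (c : R) (A : Matrix m n R) (B : Matrix n m R) :
    c ^ Fintype.card n * (c • (1 : Matrix m m R) + A * B).det =
      c ^ Fintype.card m * (c • (1 : Matrix n n R) + B * A).det := by
  have h := congrArg (Polynomial.eval c) (Matrix.charpoly_mul_comm' (-A) B)
  simpa [Matrix.eval_charpoly, Matrix.scalar_apply, ← Matrix.smul_one_eq_diagonal] using h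

lemma sum_quadraticChar_sub_mul_sub {F : Type*} [Field F] [Fintype F] [DecidableEq F]
    (hF : ringChar F ≠ 2) {x y : F} (hxy : x ≠ y) :
    ∑ z, quadraticChar F (x - z) * quadraticChar F (y - z) = -1 := by
  have hd : x - y ≠ 0 := sub_ne_zero.mpr hxy
  have hJ := jacobiSum_nontrivial_inv (quadraticChar_ne_one hF)
  rw [(quadraticChar_isQuadratic F).inv, jacobiSum] at hJ
  have hneg : quadraticChar F (-1) ^ 2 = 1 := quadraticChar_sq_one (neg_ne_zero.mpr one_ne_zero)
  rw [← ((Equiv.mulLeft₀ _ hd).trans (Equiv.subLeft x)).sum_comp]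
  calc _ = ∑ t, quadraticChar F (-1) * (quadraticChar F t * quadraticChar F (1 - t)) := by
        refine Finset.sum_congr rfl fun t _ => ?_
        change quadraticChar F (x - (x - (x - y) * t)) * quadraticChar F (y - (x - (x - y) * t)) = _
        have h1 : x - (x - (x - y) * t) = (x - y) * t := by ring
        have h2 : y - (x - (x - y) * t) = (x - y) * (-1 * (1 - t)) := by ring
        have h3 := quadraticChar_sq_one hd
        rw [h1, h2, map_mul, map_mul, map_mul]
        linear_combination (quadraticChar F t * quadraticChar F (-1) * quadraticChar F (1 - t)) * h3
    _ = -1 := by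
        rw [← Finset.mul_sum, hJ]
        linear_combination -hneg

lemma sum_quadraticChar_sub_mul_self {F : Type*} [Field F] [Fintype F] [DecidableEq F] (x : F) :
    ∑ z, quadraticChar F (x - z) * quadraticChar F (x - z) = (Fintype.card F : ℤ) - 1 := by
  rw [← (Equiv.subLeft x).sum_comp]
  simp only [Equiv.subLeft_apply, sub_sub_cancel]
  have h (t : F) : quadraticChar F t * quadraticChar F t = 1 - if t = 0 then 1 else 0 := by
    split_ifs with ht
    · simp [ht]
    · rw [← sq, quadraticChar_sq_one ht, sub_zero]
  simp_rw [h]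
  simp

lemma Matrix.det_smul_one_sub_smul_of_one {R n : Type*} [CommRing R] [Fintype n] [DecidableEq n]
    (a b : R) :
    a * (a • (1 : Matrix n n R) - b • of fun _ _ => 1).det =
      a ^ Fintype.card n * (a - b * Fintype.card n) := by
  have h := pow_card_mul_det_smul_one_add_mul_comm a
    (of fun _ _ => -b : Matrix n Unit R) (of fun _ _ => 1 : Matrix Unit n R)
  have e : (of fun _ _ => -b : Matrix n Unit R) * (of fun _ _ => 1 : Matrix Unit n R)
      = - b • of fun _ _ => 1 := by ext; simp [mul_apply]
  rw [e] at h
  have e' : (of fun _ _ => 1 : Matrix Unit n R) * (of fun _ _ => -b : Matrix n Unit R)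
      = of fun _ _ => -(Fintype.card n * b) := by ext; simp [mul_apply]
  rw [e', det_unique (n := Unit), Fintype.card_unit, pow_one, neg_smul, ← sub_eq_add_neg] at h
  rw [h]
  simp
  ring

/-- The Orrick–Solomon–Dowdeswell–Smith construction: for a prime `q ≡ 3 (mod 4)`
with Paley core `Q`, setting `P = Q ⊗ H₄ - I_q ⊗ J₄`, `R = j_q ⊗ A` (with `A` the
displayed `3 × 4` matrix and `j_q` the all-ones row vector of length `q`) and
`M = [[P, Rᵀ], [R, J₃]]`, one has `det(M·Mᵀ) = 16·(4q)^(3q+3)·(4q+16)^(q-1)`. -/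
theorem osds_construction_det (q : ℕ) [Fact q.Prime] (hq : q % 4 = 3)
    (Q : Matrix (ZMod q) (ZMod q) ℤ)
    (hQ : ∀ x y, Q x y = quadraticChar (ZMod q) (x - y))
    (H4 : Matrix (Fin 4) (Fin 4) ℤ)
    (hH4 : H4 = !![1, 1, 1, -1; 1, 1, -1, 1; 1, -1, 1, 1; -1, 1, 1, 1])
    (P : Matrix (ZMod q × Fin 4) (ZMod q × Fin 4) ℤ)
    (hP : P = Q ⊗ₖ H4
      - (1 : Matrix (ZMod q) (ZMod q) ℤ) ⊗ₖ
        (Matrix.of (fun _ _ => 1) : Matrix (Fin 4) (Fin 4) ℤ))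
    (R : Matrix (Unit × Fin 3) (ZMod q × Fin 4) ℤ)
    (hR : R = (Matrix.of (fun _ _ => 1) : Matrix Unit (ZMod q) ℤ) ⊗ₖ
      !![1, -1, 1, -1; 1, 1, -1, -1; 1, -1, -1, 1])
    (M : Matrix ((ZMod q × Fin 4) ⊕ (Unit × Fin 3)) ((ZMod q × Fin 4) ⊕ (Unit × Fin 3)) ℤ)
    (hM : M = Matrix.fromBlocks P Rᵀ R (Matrix.of fun _ _ => 1)) :
    (M * Mᵀ).det = 16 * (4 * (q : ℤ)) ^ (3 * q + 3) * (4 * (q : ℤ) + 16) ^ (q - 1) := by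
  have hq0 : 0 < q := (Fact.out : q.Prime).pos
  have hchar : ringChar (ZMod q) ≠ 2 := by rw [ZMod.ringChar_zmod_n]; omega
  set J : Matrix (Fin 4) (Fin 4) ℤ := of fun _ _ => 1 with hJ
  set j : Matrix Unit (ZMod q) ℤ := of fun _ _ => 1 with hj
  set A : Matrix (Fin 3) (Fin 4) ℤ := !![1, -1, 1, -1; 1, 1, -1, -1; 1, -1, -1, 1] with hA
  set K : Matrix (Unit × Fin 3) (Unit × Fin 3) ℤ := of fun _ _ => 1 with hK
  set E : Matrix (ZMod q) (ZMod q) ℤ := of fun _ _ => 1 with hE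
  have hQQ : Q * Qᵀ = (q : ℤ) • 1 - E := by
    ext x y
    simp only [mul_apply, transpose_apply, hQ, Matrix.sub_apply, Matrix.smul_apply]
    rcases eq_or_ne x y with rfl | hxy
    · rw [sum_quadraticChar_sub_mul_self, ZMod.card, one_apply_eq, smul_eq_mul, mul_one]
      rfl
    · rw [sum_quadraticChar_sub_mul_sub hchar hxy, one_apply_ne hxy, smul_zero]
      rfl
  have hQT : Qᵀ = -Q := by
    have hneg : quadraticChar (ZMod q) (-1) = -1 := by
      rw [quadraticChar_neg_one_iff_not_isSquare, FiniteField.isSquare_neg_one_iff, ZMod.card]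
      simpa using hq
    ext x y
    rw [transpose_apply, Matrix.neg_apply, hQ, hQ, ← neg_sub x y, ← neg_one_mul (x - y), map_mul, hneg,
      neg_one_mul]
  have hQj : Q * jᵀ = 0 := by
    ext x y
    simp only [mul_apply, transpose_apply, hQ, hj, of_apply, mul_one, Matrix.zero_apply]
    rw [← quadraticChar_sum_zero hchar]
    exact (Equiv.subLeft x).sum_comp _
  have hHT : H4ᵀ = H4 := by rw [hH4]; decide
  have hHH : H4 * H4 = (4 : ℤ) • 1 := by rw [hH4]; decide
  have hHJ : H4 * J = (2 : ℤ) • J := by rw [hH4, hJ]; decide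
  have hJH : J * H4 = (2 : ℤ) • J := by rw [hH4, hJ]; decide
  have hJJ : J * J = (4 : ℤ) • J := by rw [hJ]; decide
  have hJA : J * Aᵀ = 0 := by rw [hJ, hA]; decide
  have hATA : Aᵀ * A = (4 : ℤ) • 1 - J := by rw [hA, hJ]; decide
  have hAAT : A * Aᵀ = (4 : ℤ) • 1 := by rw [hA]; decide
  have hJT : Jᵀ = J := rfl
  have hKT : Kᵀ = K := rfl
  have hKK : K * K = (3 : ℤ) • K := by ext; simp [hK, mul_apply]
  have hjj : jᵀ * j = E := by ext; simp [hj, hE, mul_apply]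
  have hjj' : j * jᵀ = (q : ℤ) • 1 := by ext; simp [hj, mul_apply, ZMod.card]
  have hRT : Rᵀ = jᵀ ⊗ₖ Aᵀ := by rw [hR, kroneckerMap_transpose]
  have hPT : Pᵀ = Qᵀ ⊗ₖ H4 - 1 ⊗ₖ J := by
    rw [hP, transpose_sub, ← kroneckerMap_transpose, ← kroneckerMap_transpose, hHT, hJT,
      transpose_one]
  have hRR : R * Rᵀ = (4 * q : ℤ) • 1 := by
    rw [hRT, hR, ← mul_kronecker_mul, hjj', hAAT, smul_kronecker, kronecker_smul, smul_smul,
      one_kronecker_one, mul_comm]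
  have hPR : P * Rᵀ = 0 := by
    rw [hP, hRT, Matrix.sub_mul, ← mul_kronecker_mul, ← mul_kronecker_mul, hQj, hJA]
    simp
  have hRP : R * Pᵀ = 0 := by
    rw [← transpose_transpose R, ← transpose_mul, hPR, transpose_zero]
  set S : Matrix (ZMod q × Fin 4) (ZMod q × Fin 4) ℤ :=
    (4 * q : ℤ) • 1 + ((4 : ℤ) • 1 - E) ⊗ₖ J with hS
  have hPP : P * Pᵀ + Rᵀ * R = S := by
    rw [hPT, hRT, hP, hR, Matrix.sub_mul, Matrix.mul_sub, Matrix.mul_sub]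
    simp only [← mul_kronecker_mul]
    rw [hQQ, hHH, hHJ, hJH, hJJ, hjj, hATA, hQT, hS, ← one_kronecker_one]
    ext ⟨x, a⟩ ⟨y, b⟩
    simp only [Matrix.add_apply, Matrix.sub_apply, Matrix.smul_apply, Matrix.neg_apply,
      kroneckerMap_apply, smul_eq_mul, Matrix.mul_one, Matrix.one_mul]
    ring
  have hSR : S * Rᵀ = (4 * q : ℤ) • Rᵀ := by
    rw [hS, Matrix.add_mul, hRT, ← mul_kronecker_mul, hJA, kronecker_zero, add_zero, Matrix.smul_mul,
      Matrix.one_mul]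
  have hdetS : S.det = (4 * q : ℤ) ^ (3 * q) * (16 * (4 * q + 16) ^ (q - 1)) := by
    have h := pow_card_mul_det_smul_one_add_mul_comm (4 * q : ℤ)
      (((4 : ℤ) • 1 - E) ⊗ₖ (of fun _ _ => 1 : Matrix (Fin 4) Unit ℤ))
      ((1 : Matrix (ZMod q) (ZMod q) ℤ) ⊗ₖ (of fun _ _ => 1 : Matrix Unit (Fin 4) ℤ))
    have hAB : (of fun _ _ => 1 : Matrix (Fin 4) Unit ℤ) * (of fun _ _ => 1 : Matrix Unit (Fin 4) ℤ)
        = J := by decide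
    have hBA : (of fun _ _ => 1 : Matrix Unit (Fin 4) ℤ) * (of fun _ _ => 1 : Matrix (Fin 4) Unit ℤ)
        = (4 : ℤ) • 1 := by decide
    rw [← mul_kronecker_mul, ← mul_kronecker_mul, Matrix.mul_one, Matrix.one_mul, hAB, hBA, ← hS]
      at h
    have hsum : (4 * q : ℤ) • 1 + ((4 : ℤ) • 1 - E) ⊗ₖ ((4 : ℤ) • (1 : Matrix Unit Unit ℤ)) =
        (4 * q + 16 : ℤ) • 1 - (4 : ℤ) • of fun _ _ => 1 := by
      rw [← one_kronecker_one]
      ext ⟨x, a⟩ ⟨y, b⟩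
      simp only [Matrix.add_apply, Matrix.sub_apply, Matrix.smul_apply, kroneckerMap_apply,
        smul_eq_mul, of_apply, hE, Subsingleton.elim a b, one_apply_eq]
      ring
    have hd := det_smul_one_sub_smul_of_one (n := ZMod q × Unit) (4 * q + 16 : ℤ) 4
    rw [hsum] at h
    simp only [Fintype.card_prod, Fintype.card_unit, Fintype.card_fin, ZMod.card, mul_one] at h hd
    have hc : (4 * q : ℤ) ≠ 0 := by positivity
    have hc' : (4 * q + 16 : ℤ) ≠ 0 := by positivity
    refine mul_left_cancel₀ (mul_ne_zero hc' (pow_ne_zero q hc)) ?_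
    have hpow : (4 * q + 16 : ℤ) ^ q = (4 * q + 16) ^ (q - 1) * (4 * q + 16) := by
      rw [← pow_succ, Nat.sub_add_cancel hq0]
    rw [mul_assoc, h, mul_left_comm, hd, hpow]
    ring
  have hMM : M * Mᵀ = fromBlocks S (Rᵀ * K) (K * R) ((4 * q : ℤ) • 1 + (3 : ℤ) • K) := by
    rw [hM, fromBlocks_transpose, fromBlocks_multiply, transpose_transpose, hKT, hPP, hPR, hRP,
      hRR, hKK, zero_add, zero_add]
  have hmul : M * Mᵀ * fromBlocks 1 (-(Rᵀ * K)) 0 ((4 * q : ℤ) • 1) =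
      fromBlocks S 0 (K * R) (((4 * q : ℤ) ^ 2) • 1) := by
    have h1 : S * (Rᵀ * K) = (4 * q : ℤ) • (Rᵀ * K) := by
      rw [← Matrix.mul_assoc, hSR, Matrix.smul_mul]
    have h2 : K * R * (Rᵀ * K) = (12 * q : ℤ) • K := by
      rw [Matrix.mul_assoc, ← Matrix.mul_assoc R, hRR, Matrix.smul_mul, Matrix.one_mul,
        Matrix.mul_smul, hKK, smul_smul]
      ring_nf
    rw [hMM, fromBlocks_multiply, Matrix.mul_neg, Matrix.mul_neg, h1, h2]
    congr 1
    · simp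
    · simp only [Matrix.mul_smul, Matrix.mul_one, neg_add_cancel]
    · simp
    · simp only [Matrix.mul_smul, Matrix.mul_one]
      module
  have hdet := congrArg det hmul
  rw [det_mul, det_fromBlocks_zero₂₁, det_fromBlocks_zero₁₂, det_one, one_mul, det_smul, det_smul,
    det_one, hdetS] at hdet
  have hc : (4 * q : ℤ) ≠ 0 := by positivity
  simp only [Fintype.card_prod, Fintype.card_unit, Fintype.card_fin, one_mul, mul_one] at hdet
  refine mul_right_cancel₀ (pow_ne_zero 3 hc) (hdet.trans ?_)
  ring
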